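/- Let P, Q be probability measures on a measurable space (Ω, 𝓕) and φ : Ω → E a measurable function into a measurable space (E, 𝓔). Let f ∈ 𝔽 be strictly convex on (0, ∞) and assume D_f(P ‖ Q) < ∞. Then D_f(φ♯P ‖ φ♯Q) = D_f(P ‖ Q) if and only if there exists a measurable function h : E → [0, ∞] such that dP/dQ = h ∘ φ holds (P+Q)-a.e. -/

import Mathlib

open MeasureTheory ProbabilityTheory Filter Set Topology
open scoped ENNReal NNReal

noncomputable section

/-- Extended-real positive part, as a value in `ℝ≥0∞`. -/
def EReal.toENNReal' (x : EReal) : ℝ≥0∞ :=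
  if x = ⊤ then ⊤ else ENNReal.ofReal x.toReal

/-- Quasi-integrability of an extended-real-valued function: the positive part or the negative
part has finite integral. -/
def QuasiIntegrable {Ω : Type*} [MeasurableSpace Ω] (μ : Measure Ω) (g : Ω → EReal) : Prop :=
  (∫⁻ ω, (g ω).toENNReal' ∂μ) < ⊤ ∨ (∫⁻ ω, (-(g ω)).toENNReal' ∂μ) < ⊤

/-- The integral of an extended-real-valued function, defined as the difference of the
integrals of the positive and negative parts. -/
def eInt {Ω : Type*} [MeasurableSpace Ω] (μ : Measure Ω) (g : Ω → EReal) : EReal :=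
  ((∫⁻ ω, (g ω).toENNReal' ∂μ : ℝ≥0∞) : EReal) - ((∫⁻ ω, (-(g ω)).toENNReal' ∂μ : ℝ≥0∞) : EReal)

/-- `f` is strictly convex at the point `z`. -/
def StrictConvexAt (f : ℝ → EReal) (z : ℝ) : Prop :=
  ∀ x y α : ℝ, x ≠ z → y ≠ z → 0 < α → α < 1 → z = α * x + (1 - α) * y →
    f z < (α : EReal) * f x + ((1 - α : ℝ) : EReal) * f y

/-- The class `𝔽` of proper convex functions `f : ℝ → (-∞, +∞]` with domain contained in
`[0, ∞)`, right-continuous at `0`, with `f 1 = 0` and `1` in the interior of the domain. -/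
structure MemF (f : ℝ → EReal) : Prop where
  ne_bot : ∀ x, f x ≠ ⊥
  convex : ∀ x y α : ℝ, 0 ≤ α → α ≤ 1 →
    f (α * x + (1 - α) * y) ≤ (α : EReal) * f x + ((1 - α : ℝ) : EReal) * f y
  top_of_neg : ∀ x : ℝ, x < 0 → f x = ⊤
  right_continuous_at_zero : Tendsto f (nhdsWithin 0 (Set.Ioi 0)) (nhds (f 0))
  one_eq_zero : f 1 = 0
  one_mem_interior_dom : ∃ ε : ℝ, 0 < ε ∧ ∀ x : ℝ, |x - 1| < ε → f x ≠ ⊤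

/-- The value `f*(0) = lim_{t → ∞} f(t)/t` of the convex conjugate at `0`. -/
def fStarZero (f : ℝ → EReal) : EReal :=
  Filter.limsup (fun t : ℝ => ((t⁻¹ : ℝ) : EReal) * f t) Filter.atTop

/-- The convex conjugate `f*` of `f ∈ 𝔽`: `f*(t) = t f(1/t)` for `t > 0`,
`f*(0) = lim_{t→∞} f(t)/t`, and `f* = ⊤` on negative reals. -/
def fConj (f : ℝ → EReal) : ℝ → EReal := fun t =>
  if 0 < t then ((t : ℝ) : EReal) * f t⁻¹
  else if t = 0 then fStarZero f
  else ⊤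

/-- The ratio `dP/dQ` defined `(P+Q)`-a.e. via densities w.r.t. `λ = P + Q`, with the
conventions `0/0 = ∞/∞ = 0` (which are those of `ℝ≥0∞` division). -/
def rnRatio {Ω : Type*} [MeasurableSpace Ω] (P Q : Measure Ω) : Ω → ℝ≥0∞ :=
  fun ω => P.rnDeriv (P + Q) ω / Q.rnDeriv (P + Q) ω

/-- Extension of `f : ℝ → EReal` to `[0, ∞]`, with value `⊤` at `∞`. -/
def extF (f : ℝ → EReal) : ℝ≥0∞ → EReal :=
  fun x => if x = ⊤ then ⊤ else f x.toReal

/-- The `f`-divergence `D_f(P‖Q) = ∫ f(dP/dQ) dQ + f*(0) P(dP/dQ = ∞)`.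
Note that `Q(dP/dQ = ∞) = 0`, and that in `EReal` one has `f*(0) · 0 = 0`, which encodes the
convention that the second term vanishes when `P(dP/dQ = ∞) = 0`. -/
def fDiv {Ω : Type*} [MeasurableSpace Ω] (f : ℝ → EReal) (P Q : Measure Ω) : EReal :=
  eInt Q (fun ω => extF f (rnRatio P Q ω)) +
    fStarZero f * ((P {ω | rnRatio P Q ω = ⊤} : ℝ≥0∞) : EReal)

/-- The Csiszár index `S_f(X,Y) = D_f(P_X ⊗ P_Y ‖ P_{(X,Y)})`. -/
def csiszarIndex {Ω α β : Type*} [MeasurableSpace Ω] [MeasurableSpace α] [MeasurableSpace β]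
    (f : ℝ → EReal) (μ : Measure Ω) (X : Ω → α) (Y : Ω → β) : EReal :=
  fDiv f ((μ.map X).prod (μ.map Y)) (μ.map (fun ω => (X ω, Y ω)))

namespace MemF

variable {f : ℝ → EReal}

/-- Strict convexity at `x > 0` forces `f x` to be finite, as `f = ⊤` on the negative axis. -/
lemma ne_top_of_pos (hsc : ∀ z : ℝ, 0 < z → StrictConvexAt f z) {x : ℝ} (hx : 0 < x) :
    f x ≠ ⊤ :=
  ne_top_of_lt (hsc x hx (-1) (2 * x + 1) (1 / 2) (by linarith) (by linarith) (by norm_num)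
    (by norm_num) (by ring))

lemma coe_toReal (hf : MemF f) {x : ℝ} (hx : f x ≠ ⊤) : ((f x).toReal : EReal) = f x :=
  EReal.coe_toReal hx (hf.ne_bot x)

lemma toReal_lt (hf : MemF f) (hsc : ∀ z : ℝ, 0 < z → StrictConvexAt f z) {x y α : ℝ}
    (hx : f x ≠ ⊤) (hy : f y ≠ ⊤) (hxy : x ≠ y) (h0 : 0 < α) (h1 : α < 1)
    (hz : 0 < α * x + (1 - α) * y) :
    (f (α * x + (1 - α) * y)).toReal < α * (f x).toReal + (1 - α) * (f y).toReal := by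
  have hxz : x ≠ α * x + (1 - α) * y := fun h =>
    hxy (mul_left_cancel₀ (sub_ne_zero.2 h1.ne') (by linarith))
  have hyz : y ≠ α * x + (1 - α) * y := fun h =>
    hxy (mul_left_cancel₀ h0.ne' (by linarith))
  have h := hsc _ hz x y α hxz hyz h0 h1 rfl
  rw [← hf.coe_toReal hx, ← hf.coe_toReal hy, ← hf.coe_toReal (ne_top_of_pos hsc hz)] at h
  exact_mod_cast h

lemma strictConvexOn_toReal (hf : MemF f) (hsc : ∀ z : ℝ, 0 < z → StrictConvexAt f z) :
    StrictConvexOn ℝ (Ioi 0) (fun t => (f t).toReal) := by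
  refine ⟨convex_Ioi 0, fun x hx y hy hxy a b ha hb hab => ?_⟩
  obtain rfl : b = 1 - a := by linarith
  have hx : 0 < x := hx
  have hy : 0 < y := hy
  exact hf.toReal_lt hsc (ne_top_of_pos hsc hx) (ne_top_of_pos hsc hy) hxy ha (by linarith)
    (by positivity)

lemma measurable (hf : MemF f) (hsc : ∀ z : ℝ, 0 < z → StrictConvexAt f z) : Measurable f := by
  have hc := (hf.strictConvexOn_toReal hsc).convexOn.continuousOn isOpen_Ioi
  have hm : Measurable ((Ioi (0 : ℝ)).piecewise (fun t => (f t).toReal) 0) :=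
    hc.measurable_piecewise continuousOn_const measurableSet_Ioi
  have : f = fun t => if 0 < t then
      (((Ioi (0 : ℝ)).piecewise (fun t => (f t).toReal) 0 t : ℝ) : EReal)
      else if t = 0 then f 0 else ⊤ := by
    funext t
    split_ifs with h h'
    · rw [piecewise_eq_of_mem _ _ _ (show t ∈ Ioi 0 from h),
        hf.coe_toReal (ne_top_of_pos hsc h)]
    · rw [h']
    · exact hf.top_of_neg t (lt_of_le_of_ne (not_lt.1 h) h')
  rw [this]
  exact Measurable.ite measurableSet_Ioi hm.coe_real_ereal
    (Measurable.ite (measurableSet_singleton 0) measurable_const measurable_const)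

end MemF

/-- The right derivative of `f`, a subgradient on `(0, ∞)`. -/
def fSlope (f : ℝ → EReal) (b : ℝ) : ℝ :=
  derivWithin (fun t => (f t).toReal) (Ioi b) b

lemma measurable_fSlope (f : ℝ → EReal) : Measurable (fSlope f) :=
  measurable_derivWithin_Ioi _

namespace MemF

variable {f : ℝ → EReal}

lemma add_fSlope_mul_le (hf : MemF f) (hsc : ∀ z : ℝ, 0 < z → StrictConvexAt f z) {b t : ℝ}
    (hb : 0 < b) (ht : 0 < t) :
    (f b).toReal + fSlope f b * (t - b) ≤ (f t).toReal := by
  have hc := (hf.strictConvexOn_toReal hsc).convexOn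
  have hbi : b ∈ interior (Ioi (0 : ℝ)) := by rwa [interior_Ioi]
  rcases lt_trichotomy b t with h | rfl | h
  · have := hc.rightDeriv_le_slope_of_mem_interior hbi ht h
    rw [slope_def_field, le_div_iff₀ (by linarith)] at this
    change fSlope f b * _ ≤ _ at this
    linarith
  · simp
  · have := (hc.slope_le_leftDeriv_of_mem_interior ht hbi h).trans
      (hc.leftDeriv_le_rightDeriv_of_mem_interior hbi)
    rw [slope_def_field, div_le_iff₀ (by linarith)] at this
    change _ ≤ fSlope f b * _ at this
    linarith

lemma add_fSlope_mul_lt (hf : MemF f) (hsc : ∀ z : ℝ, 0 < z → StrictConvexAt f z) {b t : ℝ}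
    (hb : 0 < b) (ht : 0 ≤ t) (htop : f t ≠ ⊤) (hne : t ≠ b) :
    (f b).toReal + fSlope f b * (t - b) < (f t).toReal := by
  have hm : 0 < 1 / 2 * t + (1 - 1 / 2) * b := by linarith
  have h1 := hf.toReal_lt hsc htop (ne_top_of_pos hsc hb) hne (by norm_num) (by norm_num) hm
  have h2 := hf.add_fSlope_mul_le hsc hb hm
  linarith

lemma fSlope_lt_fStarZero (hf : MemF f) (hsc : ∀ z : ℝ, 0 < z → StrictConvexAt f z) {b : ℝ}
    (hb : 0 < b) : (fSlope f b : EReal) < fStarZero f := by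
  have hb1 : 0 < b + 1 := by linarith
  have h1 := hf.add_fSlope_mul_lt hsc hb hb1.le (ne_top_of_pos hsc hb1) (by linarith)
  have h2 := hf.add_fSlope_mul_lt hsc hb1 hb.le (ne_top_of_pos hsc hb) (by linarith)
  have hlt : fSlope f b < fSlope f (b + 1) := by linarith
  refine (EReal.coe_lt_coe_iff.2 hlt).trans_le ?_
  have hlim : Tendsto (fun t : ℝ => (((f (b + 1)).toReal - fSlope f (b + 1) * (b + 1)) * t⁻¹
      + fSlope f (b + 1) : ℝ)) atTop (𝓝 (fSlope f (b + 1))) := by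
    simpa using (tendsto_inv_atTop_zero.const_mul _).add_const (fSlope f (b + 1))
  have hlim' := (continuous_coe_real_ereal.tendsto _).comp hlim
  rw [← hlim'.limsup_eq]
  refine limsup_le_limsup ?_
  filter_upwards [eventually_gt_atTop 0] with t ht
  have h3 := hf.add_fSlope_mul_le hsc hb1 ht
  rw [← hf.coe_toReal (ne_top_of_pos hsc ht)]
  simp only [Function.comp]
  norm_cast
  calc _ = t⁻¹ * ((f (b + 1)).toReal + fSlope f (b + 1) * (t - (b + 1))) := by
        field_simp
        ring
    _ ≤ _ := by gcongr

lemma fStarZero_ne_bot (hf : MemF f) (hsc : ∀ z : ℝ, 0 < z → StrictConvexAt f z) :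
    fStarZero f ≠ ⊥ :=
  ne_bot_of_gt (hf.fSlope_lt_fStarZero hsc one_pos)

end MemF

/-- The perspective of `f` restricted to the segment `x + y = 1`, as a real-valued function of
`x`: it takes the value `(1 - x) f(x / (1 - x))` for `x ≠ 1` and `f*(0)` for `x = 1`. -/
def perspF (f : ℝ → EReal) (x : ℝ) : ℝ :=
  if x = 1 then (fStarZero f).toReal else (1 - x) * (f (x / (1 - x))).toReal

/-- The part of `[0, 1]` where the perspective of `f` is finite. -/
def perspDom (f : ℝ → EReal) : Set ℝ :=
  {x | x ∈ Icc 0 1 ∧ (x = 0 → f 0 ≠ ⊤) ∧ (x = 1 → fStarZero f ≠ ⊤)}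

/-- Value at `0` of an affine function supporting `perspF f` at `a`. -/
def suppZero (f : ℝ → EReal) (a : ℝ) : ℝ :=
  if a = 0 then (f 0).toReal else if a = 1 then 0 else
    (f (a / (1 - a))).toReal - fSlope f (a / (1 - a)) * (a / (1 - a))

/-- Value at `1` of an affine function supporting `perspF f` at `a`. -/
def suppOne (f : ℝ → EReal) (a : ℝ) : ℝ :=
  if a = 0 then 0 else if a = 1 then (fStarZero f).toReal else fSlope f (a / (1 - a))

lemma perspF_eq_supp (f : ℝ → EReal) (a : ℝ) :
    perspF f a = (1 - a) * suppZero f a + a * suppOne f a := by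
  unfold perspF suppZero suppOne
  by_cases h1 : a = 1
  · simp [h1]
  by_cases h0 : a = 0
  · simp [h0]
  have : 1 - a ≠ 0 := sub_ne_zero.2 (Ne.symm h1)
  simp only [h1, h0, if_false]
  field_simp
  ring

lemma MemF.supp_lt_perspF {f : ℝ → EReal} (hf : MemF f)
    (hsc : ∀ z : ℝ, 0 < z → StrictConvexAt f z) {a x : ℝ} (ha0 : 0 < a) (ha1 : a < 1)
    (hx : x ∈ perspDom f) (hne : x ≠ a) :
    (1 - x) * suppZero f a + x * suppOne f a < perspF f x := by
  obtain ⟨⟨hx0, hx1⟩, hd0, hd1⟩ := hx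
  have hb : 0 < a / (1 - a) := div_pos ha0 (by linarith)
  have ha : a = (1 - a) * (a / (1 - a)) := by
    have : 1 - a ≠ 0 := by linarith
    field_simp
  unfold perspF suppZero suppOne
  simp only [ha0.ne', ha1.ne, if_false]
  by_cases h1 : x = 1
  · have h := hf.fSlope_lt_fStarZero hsc hb
    rw [← EReal.coe_toReal (hd1 h1) (hf.fStarZero_ne_bot hsc)] at h
    simpa [h1] using (EReal.coe_lt_coe_iff.1 h)
  have hx1' : 0 < 1 - x := by
    have := lt_of_le_of_ne hx1 h1
    linarith
  have ht : f (x / (1 - x)) ≠ ⊤ := by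
    rcases hx0.eq_or_lt with h | h
    · simpa [← h] using hd0 h.symm
    · exact MemF.ne_top_of_pos hsc (by positivity)
  have hne' : x / (1 - x) ≠ a / (1 - a) := by
    intro h
    rw [div_eq_div_iff hx1'.ne' (by linarith)] at h
    exact hne (by linarith)
  have h := mul_lt_mul_of_pos_left
    (hf.add_fSlope_mul_lt hsc hb (by positivity) ht hne') hx1'
  have hx : x = (1 - x) * (x / (1 - x)) := by field_simp
  simp only [h1, if_false]
  calc _ = (1 - x) * ((f (a / (1 - a))).toReal
          + fSlope f (a / (1 - a)) * (x / (1 - x) - a / (1 - a))) := by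
        linear_combination fSlope f (a / (1 - a)) * hx
    _ < _ := h

section Measurability

variable {f : ℝ → EReal}

lemma measurable_perspF (hm : Measurable f) : Measurable (perspF f) :=
  Measurable.ite (measurableSet_singleton 1) measurable_const <| by fun_prop

lemma measurable_suppZero (hm : Measurable f) : Measurable (suppZero f) :=
  have := measurable_fSlope f
  Measurable.ite (measurableSet_singleton 0) measurable_const <|
    Measurable.ite (measurableSet_singleton 1) measurable_const <| by fun_prop

lemma measurable_suppOne : Measurable (suppOne f) :=
  have := measurable_fSlope f
  Measurable.ite (measurableSet_singleton 0) measurable_const <|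
    Measurable.ite (measurableSet_singleton 1) measurable_const <| by fun_prop

lemma measurable_extF (hm : Measurable f) : Measurable (extF f) :=
  Measurable.ite (measurableSet_singleton ⊤) measurable_const <| by fun_prop

end Measurability

lemma EReal.measurable_toENNReal' : Measurable EReal.toENNReal' :=
  measurable_ereal_toENNReal

lemma EReal.toENNReal'_of_ne_top {x : EReal} (hx : x ≠ ⊤) :
    x.toENNReal' = ENNReal.ofReal x.toReal :=
  if_neg hx

section Integral

variable {Ω : Type*} [MeasurableSpace Ω]

lemma ae_ne_top_of_lintegral_toENNReal' {μ : Measure Ω} {g : Ω → EReal} (hg : Measurable g)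
    (hpos : ∫⁻ ω, (g ω).toENNReal' ∂μ ≠ ⊤) : ∀ᵐ ω ∂μ, g ω ≠ ⊤ := by
  filter_upwards [ae_lt_top (EReal.measurable_toENNReal'.comp hg) hpos] with ω hω h
  simp [EReal.toENNReal', h] at hω

lemma integrable_toReal_and_eInt_eq {μ : Measure Ω} {g : Ω → EReal} (hg : Measurable g)
    (hbot : ∀ ω, g ω ≠ ⊥) (hpos : ∫⁻ ω, (g ω).toENNReal' ∂μ ≠ ⊤)
    (hneg : ∫⁻ ω, (-(g ω)).toENNReal' ∂μ ≠ ⊤) :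
    Integrable (fun ω => (g ω).toReal) μ ∧ eInt μ g = ((∫ ω, (g ω).toReal ∂μ : ℝ) : EReal) := by
  have hp : ∫⁻ ω, (g ω).toENNReal' ∂μ = ∫⁻ ω, ENNReal.ofReal (g ω).toReal ∂μ := by
    refine lintegral_congr_ae ?_
    filter_upwards [ae_ne_top_of_lintegral_toENNReal' hg hpos] with ω hω
    exact EReal.toENNReal'_of_ne_top hω
  have hn : ∫⁻ ω, (-(g ω)).toENNReal' ∂μ = ∫⁻ ω, ENNReal.ofReal (-(g ω).toReal) ∂μ := by
    refine lintegral_congr fun ω => ?_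
    rw [EReal.toENNReal'_of_ne_top (by simpa [EReal.neg_eq_top_iff] using hbot ω),
      EReal.toReal_neg_eq]
  have hInt : Integrable (fun ω => (g ω).toReal) μ := by
    refine ⟨hg.ereal_toReal.aestronglyMeasurable, ?_⟩
    rw [hasFiniteIntegral_iff_norm]
    calc ∫⁻ ω, ENNReal.ofReal ‖(g ω).toReal‖ ∂μ
        ≤ ∫⁻ ω, (ENNReal.ofReal (g ω).toReal + ENNReal.ofReal (-(g ω).toReal)) ∂μ := by
          refine lintegral_mono fun ω => ?_
          rw [Real.norm_eq_abs]
          rcases abs_cases (g ω).toReal with ⟨h, _⟩ | ⟨h, _⟩ <;> rw [h] <;> simp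
      _ = ∫⁻ ω, (g ω).toENNReal' ∂μ + ∫⁻ ω, (-(g ω)).toENNReal' ∂μ := by
          rw [lintegral_add_left hg.ereal_toReal.ennreal_ofReal, hp, hn]
      _ < ⊤ := ENNReal.add_lt_top.2 ⟨hpos.lt_top, hneg.lt_top⟩
  refine ⟨hInt, ?_⟩
  rw [eInt, integral_eq_lintegral_pos_part_sub_lintegral_neg_part hInt, ← hp, ← hn,
    EReal.coe_sub, EReal.coe_ennreal_toReal hpos, EReal.coe_ennreal_toReal hneg]

/-- Density of `P` with respect to `P + Q`, as a real-valued function. -/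
def mixDensity (P Q : Measure Ω) (ω : Ω) : ℝ := (P.rnDeriv (P + Q) ω).toReal

variable (P Q : Measure Ω)

lemma measurable_mixDensity : Measurable (mixDensity P Q) :=
  (Measure.measurable_rnDeriv _ _).ennreal_toReal

lemma measurable_rnRatio : Measurable (rnRatio P Q) :=
  (Measure.measurable_rnDeriv _ _).div (Measure.measurable_rnDeriv _ _)

lemma absolutelyContinuous_add_left : P ≪ P + Q :=
  Measure.absolutelyContinuous_of_le (Measure.le_add_right le_rfl)

lemma absolutelyContinuous_add_right : Q ≪ P + Q :=
  Measure.absolutelyContinuous_of_le (Measure.le_add_left le_rfl)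

variable [IsFiniteMeasure P] [IsFiniteMeasure Q]

lemma ae_rnDeriv_eq_mixDensity : ∀ᵐ ω ∂(P + Q), mixDensity P Q ω ∈ Icc (0 : ℝ) 1 ∧
    P.rnDeriv (P + Q) ω = ENNReal.ofReal (mixDensity P Q ω) ∧
    Q.rnDeriv (P + Q) ω = ENNReal.ofReal (1 - mixDensity P Q ω) := by
  filter_upwards [Measure.rnDeriv_add' P Q (P + Q), Measure.rnDeriv_self (P + Q)] with ω h1 h2
  rw [h2, Pi.add_apply] at h1
  have hp : P.rnDeriv (P + Q) ω ≤ 1 := h1 ▸ le_self_add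
  have hp' : P.rnDeriv (P + Q) ω ≠ ⊤ := ne_top_of_le_ne_top ENNReal.one_ne_top hp
  have he : P.rnDeriv (P + Q) ω = ENNReal.ofReal (mixDensity P Q ω) :=
    (ENNReal.ofReal_toReal hp').symm
  refine ⟨⟨ENNReal.toReal_nonneg, ?_⟩, he, ?_⟩
  · simpa [mixDensity] using ENNReal.toReal_mono ENNReal.one_ne_top hp
  · rw [ENNReal.ofReal_sub _ (by exact ENNReal.toReal_nonneg), ENNReal.ofReal_one,
      ← he, h1, ENNReal.add_sub_cancel_left hp']

lemma ae_rnRatio_eq : ∀ᵐ ω ∂(P + Q), mixDensity P Q ω ∈ Icc (0 : ℝ) 1 ∧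
    (rnRatio P Q ω = ⊤ ↔ mixDensity P Q ω = 1) ∧
    (mixDensity P Q ω ≠ 1 → rnRatio P Q ω =
      ENNReal.ofReal (mixDensity P Q ω / (1 - mixDensity P Q ω))) := by
  filter_upwards [ae_rnDeriv_eq_mixDensity P Q] with ω ⟨⟨h0, h1⟩, hp, hq⟩
  refine ⟨⟨h0, h1⟩, ⟨fun h => ?_, fun h => ?_⟩, fun h => ?_⟩
  · by_contra hne
    have : 0 < 1 - mixDensity P Q ω := sub_pos.2 (lt_of_le_of_ne h1 hne)
    rw [rnRatio, hp, hq, ← ENNReal.ofReal_div_of_pos this] at h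
    exact ENNReal.ofReal_ne_top h
  · rw [rnRatio, hp, hq, h]
    simp
  · have : 0 < 1 - mixDensity P Q ω := sub_pos.2 (lt_of_le_of_ne h1 h)
    rw [rnRatio, hp, hq, ← ENNReal.ofReal_div_of_pos this]


variable {P Q} {f : ℝ → EReal}

lemma lintegral_rnRatio_le : ∫⁻ ω, rnRatio P Q ω ∂Q ≤ P univ := by
  rw [← lintegral_rnDeriv_mul (absolutelyContinuous_add_right P Q)
    (measurable_rnRatio P Q).aemeasurable,
    ← Measure.setLIntegral_rnDeriv (absolutelyContinuous_add_left P Q), setLIntegral_univ]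
  exact lintegral_mono fun ω => ENNReal.mul_div_le

lemma lintegral_neg_extF_rnRatio_ne_top (hf : MemF f)
    (hsc : ∀ z : ℝ, 0 < z → StrictConvexAt f z) :
    ∫⁻ ω, (-(extF f (rnRatio P Q ω))).toENNReal' ∂Q ≠ ⊤ := by
  set s := |fSlope f 1|
  refine ne_top_of_le_ne_top (b := ∫⁻ ω, (ENNReal.ofReal s + ENNReal.ofReal s * rnRatio P Q ω) ∂Q)
    ?_ (lintegral_mono fun ω => ?_)
  · rw [lintegral_add_left measurable_const, lintegral_const,
      lintegral_const_mul _ (measurable_rnRatio P Q)]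
    exact ENNReal.add_ne_top.2 ⟨ENNReal.mul_ne_top ENNReal.ofReal_ne_top (measure_ne_top _ _),
      ENNReal.mul_ne_top ENNReal.ofReal_ne_top
        (ne_top_of_le_ne_top (measure_ne_top P _) lintegral_rnRatio_le)⟩
  · change (-(extF f (rnRatio P Q ω))).toENNReal' ≤ _ + _ * rnRatio P Q ω
    generalize rnRatio P Q ω = r
    by_cases hr : r = ⊤
    · simp [extF, hr, EReal.toENNReal']
    by_cases ht : f r.toReal = ⊤
    · simp [extF, ht, EReal.toENNReal']
    rw [extF, if_neg hr, EReal.toENNReal'_of_ne_top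
      (by simpa [EReal.neg_eq_top_iff] using hf.ne_bot _), EReal.toReal_neg_eq]
    nth_rewrite 2 [← ENNReal.ofReal_toReal hr]
    have hs : 0 ≤ s := abs_nonneg _
    rw [← ENNReal.ofReal_mul hs, ← ENNReal.ofReal_add hs (by positivity)]
    refine ENNReal.ofReal_le_ofReal ?_
    have h0 : (f 1).toReal = 0 := by simp [hf.one_eq_zero]
    have hle : fSlope f 1 * (r.toReal - 1) ≤ (f r.toReal).toReal := by
      rcases eq_or_ne r.toReal 1 with h | h
      · simp [h, h0]
      · have := hf.add_fSlope_mul_lt hsc one_pos ENNReal.toReal_nonneg ht h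
        linarith
    nlinarith [neg_abs_le (fSlope f 1), le_abs_self (fSlope f 1),
      mul_le_mul_of_nonneg_right (neg_abs_le (fSlope f 1)) (ENNReal.toReal_nonneg (a := r))]

lemma measure_rnRatio_eq_top : P {ω | rnRatio P Q ω = ⊤} =
    (P + Q) {ω | mixDensity P Q ω = 1} := by
  have hm : MeasurableSet {ω | mixDensity P Q ω = 1} :=
    measurable_mixDensity P Q (measurableSet_singleton 1)
  have h : P {ω | rnRatio P Q ω = ⊤} = P {ω | mixDensity P Q ω = 1} := by
    refine measure_congr ?_
    filter_upwards [absolutelyContinuous_add_left P Q (ae_rnRatio_eq P Q)] with ω hω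
    exact propext hω.2.1
  rw [h, ← Measure.setLIntegral_rnDeriv (absolutelyContinuous_add_left P Q),
    ← setLIntegral_one]
  refine setLIntegral_congr_fun_ae hm ?_
  filter_upwards [ae_rnDeriv_eq_mixDensity P Q] with ω hω h1
  rw [hω.2.1, h1, ENNReal.ofReal_one]

lemma fDiv_eq_integral_perspF (hf : MemF f) (hsc : ∀ z : ℝ, 0 < z → StrictConvexAt f z)
    (hfin : fDiv f P Q ≠ ⊤) :
    (∀ᵐ ω ∂(P + Q), mixDensity P Q ω ∈ perspDom f) ∧
      Integrable (fun ω => perspF f (mixDensity P Q ω)) (P + Q) ∧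
      fDiv f P Q = ((∫ ω, perspF f (mixDensity P Q ω) ∂(P + Q) : ℝ) : EReal) := by
  have hm := hf.measurable hsc
  have hu : Measurable fun ω => extF f (rnRatio P Q ω) :=
    (measurable_extF hm).comp (measurable_rnRatio P Q)
  have hubot : ∀ ω, extF f (rnRatio P Q ω) ≠ ⊥ := fun ω => by
    unfold extF
    split_ifs
    · simp
    · exact hf.ne_bot _
  have hneg := lintegral_neg_extF_rnRatio_ne_top (P := P) (Q := Q) hf hsc
  have hc := hf.fStarZero_ne_bot hsc
  set M := (P + Q) {ω | mixDensity P Q ω = 1} with hM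
  have hMtop : M ≠ ⊤ := measure_ne_top _ _
  have hfd : fDiv f P Q = eInt Q (fun ω => extF f (rnRatio P Q ω))
      + fStarZero f * (M : EReal) := by
    rw [fDiv, measure_rnRatio_eq_top]
  have hcM : fStarZero f * (M : EReal) ≠ ⊥ := by
    intro h
    have hM0 : (0 : EReal) ≤ M := EReal.coe_ennreal_nonneg _
    rcases EReal.mul_eq_bot _ _ |>.1 h with h | h | h | h
    · exact hc h.1
    · exact absurd h.2 (by simp)
    · exact absurd hM0 (not_le.2 h.2)
    · exact hMtop (by simpa using h.2)
  have hpos : ∫⁻ ω, (extF f (rnRatio P Q ω)).toENNReal' ∂Q ≠ ⊤ := by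
    intro h
    apply hfin
    rw [hfd, eInt, h]
    rw [← EReal.coe_ennreal_toReal hneg, EReal.coe_ennreal_top, EReal.top_sub_coe,
      EReal.top_add_of_ne_bot hcM]
  obtain ⟨hInt, heq⟩ := integrable_toReal_and_eInt_eq hu hubot hpos hneg
  have hctop : fStarZero f = ⊤ → M = 0 := by
    intro h
    by_contra hM0
    apply hfin
    have : (0 : EReal) < M := by simpa [pos_iff_ne_zero] using hM0
    rw [hfd, h, EReal.top_mul_of_pos this, heq, EReal.coe_add_top]
  have hcM' : fStarZero f * (M : EReal) = (((fStarZero f).toReal * M.toReal : ℝ) : EReal) := by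
    by_cases h : fStarZero f = ⊤
    · simp [hctop h]
    · rw [EReal.coe_mul, EReal.coe_toReal h hc, EReal.coe_ennreal_toReal hMtop]
  have hac := absolutelyContinuous_add_right P Q
  have hset : MeasurableSet {ω | mixDensity P Q ω = 1} :=
    measurable_mixDensity P Q (measurableSet_singleton 1)
  have hInt' := (integrable_rnDeriv_smul_iff hac).2 hInt
  have hind : Integrable ({ω | mixDensity P Q ω = 1}.indicator
      fun _ => (fStarZero f).toReal) (P + Q) := (integrable_const _).indicator hset
  have hae : (fun ω => perspF f (mixDensity P Q ω)) =ᵐ[P + Q] fun ω =>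
      (Q.rnDeriv (P + Q) ω).toReal • (extF f (rnRatio P Q ω)).toReal +
        {ω | mixDensity P Q ω = 1}.indicator (fun _ => (fStarZero f).toReal) ω := by
    filter_upwards [ae_rnDeriv_eq_mixDensity P Q, ae_rnRatio_eq P Q] with
      ω ⟨⟨h0, h1⟩, _, hq⟩ ⟨_, _, hr⟩
    by_cases h : mixDensity P Q ω = 1
    · simp [perspF, hq, h]
    · have hp : 0 ≤ 1 - mixDensity P Q ω := by linarith
      rw [indicator_of_notMem (by exact h), hr h, hq, perspF, if_neg h, extF,
        if_neg ENNReal.ofReal_ne_top, ENNReal.toReal_ofReal hp,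
        ENNReal.toReal_ofReal (by positivity), smul_eq_mul, add_zero]
  refine ⟨?_, (hInt'.add hind).congr hae.symm, ?_⟩
  · have hQ := ae_ne_top_of_lintegral_toENNReal' hu hpos
    have h1 : ∀ᵐ ω ∂(P + Q), Q.rnDeriv (P + Q) ω ≠ 0 → extF f (rnRatio P Q ω) ≠ ⊤ := by
      rw [← ae_withDensity_iff (Measure.measurable_rnDeriv _ _),
        Measure.withDensity_rnDeriv_eq _ _ hac]
      exact hQ
    have h2 : ∀ᵐ ω ∂(P + Q), mixDensity P Q ω = 1 → fStarZero f ≠ ⊤ := by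
      by_cases h : fStarZero f = ⊤
      · have : ∀ᵐ ω ∂(P + Q), ¬ mixDensity P Q ω = 1 := by
          rw [ae_iff]
          simp only [not_not]
          exact hctop h
        filter_upwards [this] with ω h1 h2 using absurd h2 h1
      · exact Eventually.of_forall fun _ _ => h
    filter_upwards [h1, h2, ae_rnDeriv_eq_mixDensity P Q, ae_rnRatio_eq P Q] with
      ω h1 h2 ⟨hI, _, hq⟩ ⟨_, _, hr⟩
    refine ⟨hI, fun h => ?_, h2⟩
    have hr := hr (by simp [h])
    simpa [hr, extF, h] using h1 (by simp [hq, h])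
  · rw [hfd, heq, hcM', ← EReal.coe_add, integral_congr_ae hae, integral_add hInt' hind,
      integral_rnDeriv_smul hac, integral_indicator_const _ hset, smul_eq_mul, mul_comm]
    rfl

end Integral

section Map

variable {Ω E : Type*} [MeasurableSpace Ω] [MeasurableSpace E] {P Q : Measure Ω}
  {φ : Ω → E} {f : ℝ → EReal}

lemma ae_comp_map_add (hφ : Measurable φ) {p : E → Prop}
    (h : ∀ᵐ e ∂(P.map φ + Q.map φ), p e) : ∀ᵐ ω ∂(P + Q), p (φ ω) := by
  rw [← Measure.map_add _ _ hφ] at h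
  exact ae_of_ae_map hφ.aemeasurable h

lemma fDiv_map_eq_of_rnRatio_ae_eq (hφ : Measurable φ) (hm : Measurable f)
    (h : rnRatio P Q =ᵐ[P + Q] fun ω => rnRatio (P.map φ) (Q.map φ) (φ ω)) :
    fDiv f (P.map φ) (Q.map φ) = fDiv f P Q := by
  have hr := measurable_rnRatio (P.map φ) (Q.map φ)
  have hu := (measurable_extF hm).comp hr
  have hQ := absolutelyContinuous_add_right P Q h
  have hP : P {ω | rnRatio (P.map φ) (Q.map φ) (φ ω) = ⊤} = P {ω | rnRatio P Q ω = ⊤} := by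
    refine measure_congr ?_
    filter_upwards [absolutelyContinuous_add_left P Q h] with ω hω
    exact propext (by change _ = _ ↔ _ = _; rw [hω])
  have htop : (P.map φ) {e | rnRatio (P.map φ) (Q.map φ) e = ⊤} =
      P {ω | rnRatio (P.map φ) (Q.map φ) (φ ω) = ⊤} :=
    Measure.map_apply hφ (hr (measurableSet_singleton ⊤))
  have hInt : ∀ {k : EReal → ℝ≥0∞}, Measurable k →
      ∫⁻ e, k (extF f (rnRatio (P.map φ) (Q.map φ) e)) ∂(Q.map φ) =
        ∫⁻ ω, k (extF f (rnRatio P Q ω)) ∂Q := fun hk => by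
    refine (lintegral_map (hk.comp hu) hφ).trans (lintegral_congr_ae ?_)
    filter_upwards [hQ] with ω hω
    simp only [Function.comp, hω]
  rw [fDiv, fDiv, htop, ← hP, eInt, eInt, hInt EReal.measurable_toENNReal',
    hInt (k := fun x => (-x).toENNReal') (EReal.measurable_toENNReal'.comp measurable_neg)]

variable [IsFiniteMeasure P] [IsFiniteMeasure Q]

lemma ae_abs_mixDensity_sub_le (hφ : Measurable φ) :
    ∀ᵐ ω ∂(P + Q), |mixDensity P Q ω - mixDensity (P.map φ) (Q.map φ) (φ ω)| ≤ 1 := by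
  filter_upwards [ae_rnDeriv_eq_mixDensity P Q,
    ae_comp_map_add hφ (ae_rnDeriv_eq_mixDensity (P.map φ) (Q.map φ))] with
    ω ⟨⟨h0, h1⟩, _⟩ ⟨⟨h0', h1'⟩, _⟩
  exact abs_le.2 ⟨by linarith, by linarith⟩

lemma integral_mixDensity_mul_comp (hφ : Measurable φ) {k : E → ℝ} (hk : Measurable k) :
    ∫ ω, mixDensity P Q ω * k (φ ω) ∂(P + Q) =
      ∫ ω, mixDensity (P.map φ) (Q.map φ) (φ ω) * k (φ ω) ∂(P + Q) := by
  calc _ = ∫ ω, k (φ ω) ∂P := integral_rnDeriv_smul (absolutelyContinuous_add_left P Q)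
    _ = ∫ e, k e ∂(P.map φ) := (integral_map hφ.aemeasurable hk.aestronglyMeasurable).symm
    _ = ∫ e, mixDensity (P.map φ) (Q.map φ) e * k e ∂(P.map φ + Q.map φ) :=
      (integral_rnDeriv_smul (absolutelyContinuous_add_left _ _)).symm
    _ = _ := by
      rw [← Measure.map_add _ _ hφ, integral_map hφ.aemeasurable]
      exact ((measurable_mixDensity _ _).mul hk).aestronglyMeasurable

/-- The density of the image measure is the conditional expectation of the density. -/
lemma integral_mixDensity_sub_mul_comp (hφ : Measurable φ) {k : E → ℝ} (hk : Measurable k)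
    {C : ℝ} (hC : ∀ᵐ ω ∂(P + Q), |k (φ ω)| ≤ C) :
    Integrable (fun ω => (mixDensity P Q ω - mixDensity (P.map φ) (Q.map φ) (φ ω)) * k (φ ω))
        (P + Q) ∧
      ∫ ω, (mixDensity P Q ω - mixDensity (P.map φ) (Q.map φ) (φ ω)) * k (φ ω) ∂(P + Q) = 0 := by
  have hp := measurable_mixDensity P Q
  have hπ := (measurable_mixDensity (P.map φ) (Q.map φ)).comp hφ
  have hkφ := hk.comp hφ
  have hbound : ∀ {g : Ω → ℝ}, (∀ᵐ ω ∂(P + Q), g ω ∈ Icc (0 : ℝ) 1) →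
      ∀ᵐ ω ∂(P + Q), ‖g ω * k (φ ω)‖ ≤ C := fun hg => by
    filter_upwards [hg, hC] with ω ⟨h0, h1⟩ h
    rw [norm_mul, Real.norm_of_nonneg h0, Real.norm_eq_abs]
    nlinarith [abs_nonneg (k (φ ω))]
  have h1 : Integrable (fun ω => mixDensity P Q ω * k (φ ω)) (P + Q) :=
    Integrable.of_bound (hp.mul hkφ).aestronglyMeasurable C
      (hbound ((ae_rnDeriv_eq_mixDensity P Q).mono fun _ h => h.1))
  have h2 : Integrable (fun ω => mixDensity (P.map φ) (Q.map φ) (φ ω) * k (φ ω)) (P + Q) :=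
    Integrable.of_bound (hπ.mul hkφ).aestronglyMeasurable C
      (hbound ((ae_comp_map_add hφ (ae_rnDeriv_eq_mixDensity _ _)).mono fun _ h => h.1))
  simp only [sub_mul]
  exact ⟨h1.sub h2, by
    rw [integral_sub h1 h2, integral_mixDensity_mul_comp hφ hk, sub_self]⟩

lemma mixDensity_ae_eq_of_ae_eq_comp (hφ : Measurable φ) {H : E → ℝ} (hH : Measurable H)
    (h : ∀ᵐ ω ∂(P + Q), mixDensity P Q ω = H (φ ω)) :
    ∀ᵐ ω ∂(P + Q), mixDensity P Q ω = mixDensity (P.map φ) (Q.map φ) (φ ω) := by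
  have hC : ∀ᵐ ω ∂(P + Q), |H (φ ω) - mixDensity (P.map φ) (Q.map φ) (φ ω)| ≤ 1 := by
    filter_upwards [h, ae_abs_mixDensity_sub_le (P := P) (Q := Q) hφ] with ω h1 h2
    rwa [← h1]
  obtain ⟨hi, h0⟩ := integral_mixDensity_sub_mul_comp hφ
    (hH.sub (measurable_mixDensity (P.map φ) (Q.map φ))) hC
  have hnn : 0 ≤ᵐ[P + Q] fun ω =>
      (mixDensity P Q ω - mixDensity (P.map φ) (Q.map φ) (φ ω)) *
        (H - mixDensity (P.map φ) (Q.map φ)) (φ ω) := by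
    filter_upwards [h] with ω hω
    rw [Pi.sub_apply, ← hω]
    exact mul_self_nonneg _
  filter_upwards [h, (integral_eq_zero_iff_of_nonneg_ae hnn hi).1 h0] with ω hω hz
  rw [Pi.sub_apply, ← hω] at hz
  exact sub_eq_zero.1 (mul_self_eq_zero.1 hz)

lemma rnRatio_ae_eq_comp_of_mixDensity (hφ : Measurable φ)
    (h : ∀ᵐ ω ∂(P + Q), mixDensity P Q ω = mixDensity (P.map φ) (Q.map φ) (φ ω)) :
    rnRatio P Q =ᵐ[P + Q] fun ω => rnRatio (P.map φ) (Q.map φ) (φ ω) := by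
  filter_upwards [h, ae_rnDeriv_eq_mixDensity P Q,
    ae_comp_map_add hφ (ae_rnDeriv_eq_mixDensity (P.map φ) (Q.map φ))] with
    ω h ⟨_, hp, hq⟩ ⟨_, hp', hq'⟩
  rw [rnRatio, rnRatio, hp, hq, hp', hq', h]

lemma rnRatio_ae_eq_comp_map (hφ : Measurable φ) {h : E → ℝ≥0∞} (hh : Measurable h)
    (heq : rnRatio P Q =ᵐ[P + Q] fun ω => h (φ ω)) :
    rnRatio P Q =ᵐ[P + Q] fun ω => rnRatio (P.map φ) (Q.map φ) (φ ω) := by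
  have hH : Measurable fun e => if h e = ⊤ then (1 : ℝ) else (h e).toReal / (1 + (h e).toReal) :=
    Measurable.ite (hh (measurableSet_singleton ⊤)) measurable_const <| by fun_prop
  refine rnRatio_ae_eq_comp_of_mixDensity hφ (mixDensity_ae_eq_of_ae_eq_comp hφ hH ?_)
  filter_upwards [heq, ae_rnRatio_eq P Q] with ω hω ⟨⟨h0, h1⟩, htop, hr⟩
  rw [← hω]
  by_cases hp : mixDensity P Q ω = 1
  · rw [if_pos (htop.2 hp), hp]
  · have : 0 < 1 - mixDensity P Q ω := sub_pos.2 (lt_of_le_of_ne h1 hp)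
    rw [hr hp, if_neg ENNReal.ofReal_ne_top, ENNReal.toReal_ofReal (by positivity)]
    field_simp
    ring

/-- Strict conditional Jensen inequality for the perspective of `f`. -/
lemma mixDensity_ae_eq_of_fDiv_map_eq (hφ : Measurable φ) (hf : MemF f)
    (hsc : ∀ z : ℝ, 0 < z → StrictConvexAt f z) (hfin : fDiv f P Q ≠ ⊤)
    (heq : fDiv f (P.map φ) (Q.map φ) = fDiv f P Q) :
    ∀ᵐ ω ∂(P + Q), mixDensity P Q ω = mixDensity (P.map φ) (Q.map φ) (φ ω) := by
  obtain ⟨hdom, hInt, hval⟩ := fDiv_eq_integral_perspF hf hsc hfin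
  obtain ⟨-, hInt', hval'⟩ := fDiv_eq_integral_perspF hf hsc (heq ▸ hfin)
  have hm := hf.measurable hsc
  set p := mixDensity P Q
  set π := mixDensity (P.map φ) (Q.map φ)
  have hπm : Measurable π := measurable_mixDensity _ _
  have hmeas : AEStronglyMeasurable (fun e => perspF f (π e)) ((P + Q).map φ) :=
    ((measurable_perspF hm).comp hπm).aestronglyMeasurable
  rw [← Measure.map_add _ _ hφ] at hInt' hval'
  rw [integral_map hφ.aemeasurable hmeas] at hval'
  replace hInt' := (integrable_map_measure hmeas hφ.aemeasurable).1 hInt'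
  have hend : ∀ᵐ ω ∂(P + Q), (π (φ ω) = 0 → p ω = 0) ∧ (π (φ ω) = 1 → p ω = 1) := by
    have hk : Measurable fun e => if π e = 0 then (1 : ℝ) else if π e = 1 then -1 else 0 :=
      Measurable.ite (hπm (measurableSet_singleton 0)) measurable_const <|
        Measurable.ite (hπm (measurableSet_singleton 1)) measurable_const measurable_const
    obtain ⟨hi, h0⟩ := integral_mixDensity_sub_mul_comp (P := P) (Q := Q) hφ hk (C := 1)
      (Eventually.of_forall fun ω => by split_ifs <;> simp)
    have hnn : 0 ≤ᵐ[P + Q] fun ω => (p ω - π (φ ω)) *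
        (if π (φ ω) = 0 then (1 : ℝ) else if π (φ ω) = 1 then -1 else 0) := by
      filter_upwards [hdom] with ω ⟨⟨h0, h1⟩, _⟩
      simp only [Pi.zero_apply]
      split_ifs with ha hb
      · linarith
      · linarith
      · simp
    filter_upwards [(integral_eq_zero_iff_of_nonneg_ae hnn hi).1 h0] with ω hz
    simp only [Pi.zero_apply] at hz
    refine ⟨fun h => by simpa [h] using hz, fun h => ?_⟩
    simp only [h, one_ne_zero, if_false, if_true] at hz
    linarith
  set Δ : Ω → ℝ := fun ω =>
    perspF f (p ω) - ((1 - p ω) * suppZero f (π (φ ω)) + p ω * suppOne f (π (φ ω))) with hΔ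
  have hΔ_pos : ∀ᵐ ω ∂(P + Q), 0 ≤ Δ ω ∧ (Δ ω = 0 → p ω = π (φ ω)) := by
    filter_upwards [hdom, hend, ae_comp_map_add hφ (ae_rnDeriv_eq_mixDensity _ _)] with
      ω hd ⟨he0, he1⟩ ⟨⟨h0, h1⟩, _⟩
    by_cases hne : p ω = π (φ ω)
    · refine ⟨?_, fun _ => hne⟩
      simp only [hΔ, ← hne]
      rw [← perspF_eq_supp, sub_self]
    · have h0' : 0 < π (φ ω) := lt_of_le_of_ne h0 fun h => hne (by rw [he0 h.symm, ← h])
      have h1' : π (φ ω) < 1 := lt_of_le_of_ne h1 fun h => hne (by rw [he1 h, h])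
      have := sub_pos.2 (hf.supp_lt_perspF hsc h0' h1' hd hne)
      exact ⟨this.le, fun h => absurd h this.ne'⟩
  set K : ℕ → Set E := fun n => {e | |suppZero f (π e)| ≤ n ∧ |suppOne f (π e)| ≤ n}
  have hA : Measurable fun e => suppZero f (π e) := (measurable_suppZero hm).comp hπm
  have hB : Measurable fun e => suppOne f (π e) := measurable_suppOne.comp hπm
  have hKm : ∀ n, MeasurableSet (K n) := fun n =>
    (measurableSet_le hA.abs measurable_const).inter
      (measurableSet_le hB.abs measurable_const)
  have hSm : ∀ n, MeasurableSet (φ ⁻¹' K n) := fun n => hφ (hKm n)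
  have hmono : Monotone fun n => φ ⁻¹' K n := fun m n hmn ω hω =>
    have : (m : ℝ) ≤ n := by exact_mod_cast hmn
    ⟨hω.1.trans this, hω.2.trans this⟩
  have huniv : ⋃ n, φ ⁻¹' K n = univ := by
    refine eq_univ_of_forall fun ω => mem_iUnion.2 ?_
    obtain ⟨n, hn⟩ := exists_nat_ge
      (max |suppZero f (π (φ ω))| |suppOne f (π (φ ω))|)
    exact ⟨n, (le_max_left _ _).trans hn, (le_max_right _ _).trans hn⟩
  set d : Ω → ℝ := fun ω => perspF f (p ω) - perspF f (π (φ ω)) with hd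
  have hdint : Integrable d (P + Q) := hInt.sub hInt'
  have hdzero : ∫ ω, d ω ∂(P + Q) = 0 := by
    have : ∫ ω, perspF f (π (φ ω)) ∂(P + Q) = ∫ ω, perspF f (p ω) ∂(P + Q) :=
      EReal.coe_injective (by rw [← hval, ← heq, hval'])
    exact (integral_sub hInt hInt').trans (by rw [Function.comp_def, this, sub_self])
  have hset : ∀ n, IntegrableOn Δ (φ ⁻¹' K n) (P + Q) ∧
      ∫ ω in φ ⁻¹' K n, Δ ω ∂(P + Q) = ∫ ω in φ ⁻¹' K n, d ω ∂(P + Q) := by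
    intro n
    have hk : Measurable ((K n).indicator fun e => suppOne f (π e) - suppZero f (π e)) :=
      (hB.sub hA).indicator (hKm n)
    obtain ⟨hi, h0⟩ := integral_mixDensity_sub_mul_comp (P := P) (Q := Q) hφ hk (C := 2 * n)
      (Eventually.of_forall fun ω => by
        by_cases h : φ ω ∈ K n
        · rw [indicator_of_mem h]
          exact (abs_sub _ _).trans (by linarith [h.1, h.2])
        · rw [indicator_of_notMem h]
          simp)
    have hcongr : EqOn Δ (fun ω => d ω - (p ω - π (φ ω)) *
        (K n).indicator (fun e => suppOne f (π e) - suppZero f (π e)) (φ ω)) (φ ⁻¹' K n) := by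
      intro ω hω
      simp only [hΔ, hd]
      rw [indicator_of_mem (show φ ω ∈ K n from hω), perspF_eq_supp f (π (φ ω))]
      ring
    refine ⟨IntegrableOn.congr_fun (hdint.sub hi).integrableOn hcongr.symm (hSm n), ?_⟩
    rw [← setIntegral_eq_integral_of_forall_compl_eq_zero (s := φ ⁻¹' K n) (fun ω hω => by
      rw [indicator_of_notMem (show φ ω ∉ K n from hω), mul_zero])] at h0
    rw [setIntegral_congr_fun (hSm n) hcongr, integral_sub hdint.integrableOn hi.integrableOn, h0,
      sub_zero]
  have hΔnn : 0 ≤ᵐ[P + Q] Δ := hΔ_pos.mono fun _ h => h.1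
  have hΔmono : Monotone fun n => ∫ ω in φ ⁻¹' K n, Δ ω ∂(P + Q) := fun m n hmn =>
    setIntegral_mono_set (hset n).1 (ae_restrict_of_ae hΔnn) (hmono hmn).eventuallyLE
  have hlim : Tendsto (fun n => ∫ ω in φ ⁻¹' K n, Δ ω ∂(P + Q)) atTop (𝓝 0) := by
    have h := tendsto_setIntegral_of_monotone (μ := P + Q) (f := d) hSm hmono
      hdint.integrableOn
    rw [huniv, setIntegral_univ, hdzero] at h
    simpa only [(hset _).2] using h
  have hΔzero : ∀ᵐ ω ∂(P + Q), ∀ n, φ ω ∈ K n → Δ ω = 0 := by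
    refine ae_all_iff.2 fun n => ?_
    have h0 : ∫ ω in φ ⁻¹' K n, Δ ω ∂(P + Q) = 0 :=
      le_antisymm (hΔmono.ge_of_tendsto hlim n)
        (integral_nonneg_of_ae (ae_restrict_of_ae hΔnn))
    exact (ae_restrict_iff' (hSm n)).1
      ((setIntegral_eq_zero_iff_of_nonneg_ae (ae_restrict_of_ae hΔnn) (hset n).1).1 h0)
  filter_upwards [hΔ_pos, hΔzero] with ω h1 h2
  obtain ⟨n, hn⟩ := mem_iUnion.1 (huniv ▸ mem_univ ω : ω ∈ ⋃ n, φ ⁻¹' K n)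
  exact h1.2 (h2 n hn)

end Map

/-- **Equality case in the data-processing inequality.** If `f ∈ 𝔽` is strictly convex on
`(0, ∞)` and `D_f(P‖Q)` is finite, then `D_f(φ♯P‖φ♯Q) = D_f(P‖Q)` if and only if `dP/dQ`
is `(P+Q)`-a.e. equal to a measurable function of `φ`. -/
theorem fDiv_map_eq_iff_rnRatio_measurable
    {Ω E : Type*} [MeasurableSpace Ω] [MeasurableSpace E]
    (P Q : Measure Ω) [IsProbabilityMeasure P] [IsProbabilityMeasure Q]
    (φ : Ω → E) (hφ : Measurable φ)
    (f : ℝ → EReal) (hf : MemF f)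
    (hsc : ∀ z : ℝ, 0 < z → StrictConvexAt f z)
    (hfin : fDiv f P Q ≠ ⊤) :
    fDiv f (P.map φ) (Q.map φ) = fDiv f P Q ↔
      ∃ h : E → ℝ≥0∞, Measurable h ∧ rnRatio P Q =ᵐ[P + Q] fun ω => h (φ ω) := by
  constructor
  · intro heq
    exact ⟨rnRatio (P.map φ) (Q.map φ), measurable_rnRatio _ _,
      rnRatio_ae_eq_comp_of_mixDensity hφ
        (mixDensity_ae_eq_of_fDiv_map_eq hφ hf hsc hfin heq)⟩
  · rintro ⟨h, hh, heq⟩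
    exact fDiv_map_eq_of_rnRatio_ae_eq hφ (hf.measurable hsc) (rnRatio_ae_eq_comp_map hφ hh heq)
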